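/- Strong Morita equivalence of unital C*-algebras is an equivalence relation: it is reflexive (A is an A–A imprimitivity bimodule over itself), symmetric (the conjugate module of an A–B imprimitivity bimodule is a B–A imprimitivity bimodule), and transitive (the interior tensor product of an A–B and a B–C imprimitivity bimodule is an A–C imprimitivity bimodule). -/

import Mathlib

universe u

/-- An `A`–`B` imprimitivity bimodule: a full left Hilbert `A`-module and full right
Hilbert `B`-module with compatible actions satisfying `A⟨x,y⟩·z = x·⟨y,z⟩_B`. -/
structure ImprimitivityBimodule (A B : Type u)
    [CStarAlgebra A] [PartialOrder A] [StarOrderedRing A]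
    [CStarAlgebra B] [PartialOrder B] [StarOrderedRing B] : Type (u + 1) where
  carrier : Type u
  [normed : NormedAddCommGroup carrier]
  [complete : CompleteSpace carrier]
  smulL : A → carrier → carrier
  smulR : carrier → B → carrier
  innerL : carrier → carrier → A
  innerR : carrier → carrier → B
  hL_one : ∀ x, smulL 1 x = x
  hL_mul : ∀ (a a' : A) (x), smulL (a * a') x = smulL a (smulL a' x)
  hL_add : ∀ (a : A) (x y), smulL a (x + y) = smulL a x + smulL a y
  hL_add' : ∀ (a a' : A) (x), smulL (a + a') x = smulL a x + smulL a' x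
  hR_one : ∀ x, smulR x 1 = x
  hR_mul : ∀ (x) (b b' : B), smulR x (b * b') = smulR (smulR x b) b'
  hR_add : ∀ (x y) (b : B), smulR (x + y) b = smulR x b + smulR y b
  hR_add' : ∀ (x) (b b' : B), smulR x (b + b') = smulR x b + smulR x b'
  h_compat : ∀ (a : A) (x) (b : B), smulR (smulL a x) b = smulL a (smulR x b)
  hiL_add : ∀ x y z, innerL (x + y) z = innerL x z + innerL y z
  hiL_smul : ∀ (a : A) (x y), innerL (smulL a x) y = a * innerL x y
  hiL_star : ∀ x y, innerL y x = star (innerL x y)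
  hiL_pos : ∀ x, 0 ≤ innerL x x
  hiL_def : ∀ x, innerL x x = 0 → x = 0
  hiR_add : ∀ x y z, innerR x (y + z) = innerR x y + innerR x z
  hiR_smul : ∀ (x y) (b : B), innerR x (smulR y b) = innerR x y * b
  hiR_star : ∀ x y, innerR y x = star (innerR x y)
  hiR_pos : ∀ x, 0 ≤ innerR x x
  hiR_def : ∀ x, innerR x x = 0 → x = 0
  h_fullL : closure (↑(Submodule.span ℂ
    (Set.range fun p : carrier × carrier => innerL p.1 p.2)) : Set A) = Set.univ
  h_fullR : closure (↑(Submodule.span ℂ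
    (Set.range fun p : carrier × carrier => innerR p.1 p.2)) : Set B) = Set.univ
  h_norm : ∀ x, ‖x‖ ^ 2 = ‖innerR x x‖
  h_imp : ∀ x y z, smulL (innerL x y) z = smulR x (innerR y z)

/-- Two unital C*-algebras are strongly Morita equivalent if there exists an
imprimitivity bimodule between them. -/
def StronglyMoritaEquivalent (A B : Type u)
    [CStarAlgebra A] [PartialOrder A] [StarOrderedRing A]
    [CStarAlgebra B] [PartialOrder B] [StarOrderedRing B] : Prop :=
  Nonempty (ImprimitivityBimodule A B)

namespace ImprimitivityBimodule

open CStarAlgebra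

attribute [instance] ImprimitivityBimodule.normed ImprimitivityBimodule.complete

section Positive

variable {A B : Type u} [CStarAlgebra A] [PartialOrder A] [StarOrderedRing A]
  [CStarAlgebra B] [PartialOrder B] [StarOrderedRing B]

/-- A positive additive map of unital C*-algebras attains its norm at the unit. -/
theorem norm_map_le_of_nonneg (f : A →+ B) (hf : ∀ a, 0 ≤ a → 0 ≤ f a) {a : A} (ha : 0 ≤ a) :
    ‖f a‖ ≤ ‖a‖ * ‖f 1‖ := by
  have key : ∀ q : ℚ, ‖a‖ < q → ‖f a‖ ≤ q * ‖f 1‖ := by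
    intro q hq
    have hq0 : (0 : ℝ) < q := (norm_nonneg a).trans_lt hq
    have hqn : 0 ≤ q.num := by
      rw [Rat.num_nonneg]; exact_mod_cast hq0.le
    obtain ⟨p, hp⟩ := Int.eq_ofNat_of_zero_le hqn
    have hd : (0 : ℝ) < q.den := by exact_mod_cast q.den_pos
    have hqe : (q : ℝ) = p / q.den := by
      rw [Rat.cast_def, hp]; simp
    have hle : (q.den • a : A) ≤ p • (1 : A) := by
      have h1 : ‖(q.den • a : A)‖ ≤ p := by
        rw [← Nat.cast_smul_eq_nsmul ℝ, norm_smul, Real.norm_natCast]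
        rw [hqe, lt_div_iff₀ hd] at hq
        linarith
      have h2 := (IsSelfAdjoint.of_nonneg (nsmul_nonneg ha q.den)).le_algebraMap_norm_self
      refine h2.trans ?_
      have h3 : algebraMap ℝ A ‖(q.den • a : A)‖ ≤ algebraMap ℝ A p :=
        algebraMap_mono A h1
      simpa [nsmul_eq_mul] using h3
    have hfle : (q.den • f a : B) ≤ p • f 1 := by
      have := hf _ (sub_nonneg.2 hle)
      rwa [map_sub, map_nsmul, map_nsmul, sub_nonneg] at this
    have hn := norm_le_norm_of_nonneg_of_le (nsmul_nonneg (hf a ha) q.den) hfle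
    rw [← Nat.cast_smul_eq_nsmul ℝ, ← Nat.cast_smul_eq_nsmul ℝ, norm_smul, norm_smul,
      Real.norm_natCast, Real.norm_natCast] at hn
    rw [hqe, div_mul_eq_mul_div, le_div_iff₀ hd]
    linarith
  refine le_of_forall_pos_le_add fun ε hε => ?_
  have hpos : 0 < ‖f 1‖ + 1 := by positivity
  obtain ⟨q, hq1, hq2⟩ := exists_rat_btwn
    (show ‖a‖ < ‖a‖ + ε / (‖f 1‖ + 1) from lt_add_of_pos_right _ (div_pos hε hpos))
  calc ‖f a‖ ≤ q * ‖f 1‖ := key q hq1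
    _ ≤ (‖a‖ + ε / (‖f 1‖ + 1)) * ‖f 1‖ := by gcongr
    _ = ‖a‖ * ‖f 1‖ + ε * (‖f 1‖ / (‖f 1‖ + 1)) := by ring
    _ ≤ ‖a‖ * ‖f 1‖ + ε := by
      have : ‖f 1‖ / (‖f 1‖ + 1) ≤ 1 := (div_le_one hpos).2 (by linarith)
      nlinarith

end Positive

section Basic

variable {A B : Type u} [CStarAlgebra A] [PartialOrder A] [StarOrderedRing A]
  [CStarAlgebra B] [PartialOrder B] [StarOrderedRing B] (M : ImprimitivityBimodule A B)

/-- The left action as a biadditive map. -/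
def actL : A →+ M.carrier →+ M.carrier :=
  AddMonoidHom.mk' (fun a => AddMonoidHom.mk' (M.smulL a) (M.hL_add a))
    fun a a' => AddMonoidHom.ext (M.hL_add' a a')

/-- The right action as a biadditive map. -/
def actR : M.carrier →+ B →+ M.carrier :=
  AddMonoidHom.mk' (fun x => AddMonoidHom.mk' (M.smulR x) (M.hR_add' x))
    fun x y => AddMonoidHom.ext (M.hR_add x y)

theorem hiL_add_right (x y z : M.carrier) : M.innerL x (y + z) = M.innerL x y + M.innerL x z := by
  rw [M.hiL_star, M.hiL_add, star_add, ← M.hiL_star, ← M.hiL_star]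

theorem hiR_add_left (x y z : M.carrier) : M.innerR (x + y) z = M.innerR x z + M.innerR y z := by
  rw [M.hiR_star, M.hiR_add, star_add, ← M.hiR_star, ← M.hiR_star]

/-- The left inner product as a biadditive map. -/
def ipL : M.carrier →+ M.carrier →+ A :=
  AddMonoidHom.mk' (fun x => AddMonoidHom.mk' (M.innerL x) (M.hiL_add_right x))
    fun x y => AddMonoidHom.ext (M.hiL_add x y)

/-- The right inner product as a biadditive map. -/
def ipR : M.carrier →+ M.carrier →+ B :=
  AddMonoidHom.mk' (fun x => AddMonoidHom.mk' (M.innerR x) (M.hiR_add x))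
    fun x y => AddMonoidHom.ext (M.hiR_add_left x y)

theorem smulL_sub (a : A) (x y : M.carrier) :
    M.smulL a (x - y) = M.smulL a x - M.smulL a y := map_sub (M.actL a) x y

theorem smulL_zero (a : A) : M.smulL a 0 = 0 := map_zero (M.actL a)

theorem smulL_sum {ι : Type*} (s : Finset ι) (a : A) (f : ι → M.carrier) :
    M.smulL a (∑ i ∈ s, f i) = ∑ i ∈ s, M.smulL a (f i) := map_sum (M.actL a) f s

theorem sum_smulL {ι : Type*} (s : Finset ι) (f : ι → A) (x : M.carrier) :
    M.smulL (∑ i ∈ s, f i) x = ∑ i ∈ s, M.smulL (f i) x := map_sum (M.actL.flip x) f s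

theorem smulR_sum {ι : Type*} (s : Finset ι) (x : M.carrier) (f : ι → B) :
    M.smulR x (∑ i ∈ s, f i) = ∑ i ∈ s, M.smulR x (f i) := map_sum (M.actR x) f s

theorem innerL_sub_left (x y z : M.carrier) :
    M.innerL (x - y) z = M.innerL x z - M.innerL y z := map_sub (M.ipL.flip z) x y

theorem innerL_sub_right (x y z : M.carrier) :
    M.innerL x (y - z) = M.innerL x y - M.innerL x z := map_sub (M.ipL x) y z

theorem innerL_sum_left {ι : Type*} (s : Finset ι) (f : ι → M.carrier) (x : M.carrier) :
    M.innerL (∑ i ∈ s, f i) x = ∑ i ∈ s, M.innerL (f i) x := map_sum (M.ipL.flip x) f s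

theorem innerR_sub_right (x y z : M.carrier) :
    M.innerR x (y - z) = M.innerR x y - M.innerR x z := map_sub (M.ipR x) y z

theorem innerR_zero_right (x : M.carrier) : M.innerR x 0 = 0 := map_zero (M.ipR x)

theorem innerR_sum_right {ι : Type*} (s : Finset ι) (x : M.carrier) (f : ι → M.carrier) :
    M.innerR x (∑ i ∈ s, f i) = ∑ i ∈ s, M.innerR x (f i) := map_sum (M.ipR x) f s

theorem innerL_smul_right (a : A) (x y : M.carrier) :
    M.innerL x (M.smulL a y) = M.innerL x y * star a := by
  rw [M.hiL_star, M.hiL_smul, star_mul, ← M.hiL_star]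

theorem innerR_smul_left (x y : M.carrier) (b : B) :
    M.innerR (M.smulR x b) y = star b * M.innerR x y := by
  rw [M.hiR_star, M.hiR_smul, star_mul, ← M.hiR_star]

/-- Elements orthogonal to everything vanish. -/
theorem eq_of_innerR {x y : M.carrier} (h : ∀ z, M.innerR z x = M.innerR z y) : x = y := by
  rw [← sub_eq_zero]
  apply M.hiR_def
  rw [innerR_sub_right, h, sub_self]

/-- The unit is a finite sum of inner products, since the dense ideal they span contains an
invertible element. -/
theorem exists_sum_eq_one_of_dense {D X : Type u} [CStarAlgebra D] (ip : X → X → D)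
    (act : D → X → X) (hact : ∀ d x y, ip (act d x) y = d * ip x y)
    (hd : closure (↑(Submodule.span ℂ (Set.range fun p : X × X => ip p.1 p.2)) : Set D)
      = Set.univ) :
    ∃ (n : ℕ) (x y : Fin n → X), ∑ i, ip (x i) (y i) = 1 := by
  have h1 : (1 : D) ∈ closure
      (↑(Submodule.span ℂ (Set.range fun p : X × X => ip p.1 p.2)) : Set D) := by
    rw [hd]; trivial
  obtain ⟨s, hs, hs1⟩ := Metric.mem_closure_iff.1 h1 1 one_pos
  rw [dist_eq_norm] at hs1
  obtain ⟨u, hu⟩ : IsUnit s := by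
    have := isUnit_one_sub_of_norm_lt_one hs1
    rwa [sub_sub_cancel] at this
  have hspan : ∀ s ∈ Submodule.span ℂ (Set.range fun p : X × X => ip p.1 p.2),
      ∃ (n : ℕ) (x y : Fin n → X), ∑ i, ip (x i) (y i) = s := by
    intro s hs
    induction hs using Submodule.span_induction with
    | mem z hz =>
      obtain ⟨p, rfl⟩ := hz
      exact ⟨1, fun _ => p.1, fun _ => p.2, by simp⟩
    | zero => exact ⟨0, Fin.elim0, Fin.elim0, by simp⟩
    | add z w _ _ hz hw =>
      obtain ⟨n, x, y, rfl⟩ := hz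
      obtain ⟨m, x', y', rfl⟩ := hw
      exact ⟨n + m, Fin.append x x', Fin.append y y', by simp [Fin.sum_univ_add]⟩
    | smul c z _ hz =>
      obtain ⟨n, x, y, rfl⟩ := hz
      refine ⟨n, fun i => act (c • 1) (x i), y, ?_⟩
      simp [hact, Finset.smul_sum]
  obtain ⟨n, x, y, h⟩ := hspan s hs
  refine ⟨n, fun i => act (↑u⁻¹) (x i), y, ?_⟩
  simp only [hact]
  rw [← Finset.mul_sum, h, ← hu, Units.inv_mul]

theorem exists_sum_innerL_eq_one :
    ∃ (n : ℕ) (x y : Fin n → M.carrier), ∑ i, M.innerL (x i) (y i) = 1 :=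
  exists_sum_eq_one_of_dense M.innerL M.smulL M.hiL_smul M.h_fullL

theorem exists_sum_innerR_eq_one :
    ∃ (n : ℕ) (x y : Fin n → M.carrier), ∑ i, M.innerR (x i) (y i) = 1 :=
  exists_sum_eq_one_of_dense M.innerR (fun b x => M.smulR x (star b))
    (fun d x y => by rw [innerR_smul_left, star_star]) M.h_fullR

theorem eq_of_smulL {a a' : A} (h : ∀ x, M.smulL a x = M.smulL a' x) : a = a' := by
  obtain ⟨n, x, y, hxy⟩ := M.exists_sum_innerL_eq_one
  rw [← mul_one a, ← mul_one a', ← hxy, Finset.mul_sum, Finset.mul_sum]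
  simp only [← M.hiL_smul, h]

theorem eq_of_smulR {b b' : B} (h : ∀ x, M.smulR x b = M.smulR x b') : b = b' := by
  obtain ⟨n, x, y, hxy⟩ := M.exists_sum_innerR_eq_one
  rw [← one_mul b, ← one_mul b', ← hxy, Finset.sum_mul, Finset.sum_mul]
  simp only [← M.hiR_smul, h]

theorem innerR_smulL_left (a : A) (x y : M.carrier) :
    M.innerR (M.smulL a x) y = M.innerR x (M.smulL (star a) y) := by
  refine M.eq_of_smulR fun z => ?_
  rw [← M.h_imp, ← M.h_imp, innerL_smul_right, M.hL_mul]

theorem innerL_smulR_left (x y : M.carrier) (b : B) :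
    M.innerL (M.smulR x b) y = M.innerL x (M.smulR y (star b)) := by
  refine M.eq_of_smulL fun z => ?_
  rw [M.h_imp, M.h_imp, innerR_smul_left, star_star, M.hR_mul]

theorem innerR_smulL_smulL (a : A) (x : M.carrier) :
    M.innerR (M.smulL a x) (M.smulL a x) = M.innerR x (M.smulL (star a * a) x) := by
  rw [innerR_smulL_left, M.hL_mul]

theorem innerL_smulR_smulR (x : M.carrier) (b : B) :
    M.innerL (M.smulR x b) (M.smulR x b) = M.innerL (M.smulR x (b * star b)) x := by
  rw [M.hR_mul, innerL_smulR_left _ _ _ (star b), star_star]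

theorem norm_innerR_smulL_le (a : A) (x : M.carrier) :
    ‖M.innerR (M.smulL a x) (M.smulL a x)‖ ≤ ‖a‖ ^ 2 * ‖M.innerR x x‖ := by
  have h := norm_map_le_of_nonneg ((M.ipR x).comp (M.actL.flip x)) (fun a ha => by
    obtain ⟨c, rfl⟩ := CStarAlgebra.nonneg_iff_eq_star_mul_self.1 ha
    change 0 ≤ M.innerR x (M.smulL (star c * c) x)
    rw [← innerR_smulL_smulL]
    exact M.hiR_pos _) (star_mul_self_nonneg a)
  change ‖M.innerR x (M.smulL (star a * a) x)‖ ≤ _ * ‖M.innerR x (M.smulL 1 x)‖ at h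
  rwa [← innerR_smulL_smulL, M.hL_one, CStarRing.norm_star_mul_self, ← pow_two] at h

theorem norm_innerL_smulR_le (x : M.carrier) (b : B) :
    ‖M.innerL (M.smulR x b) (M.smulR x b)‖ ≤ ‖b‖ ^ 2 * ‖M.innerL x x‖ := by
  have h := norm_map_le_of_nonneg ((M.ipL.flip x).comp (M.actR x)) (fun b hb => by
    obtain ⟨c, rfl⟩ := CStarAlgebra.nonneg_iff_eq_mul_star_self.1 hb
    change 0 ≤ M.innerL (M.smulR x (c * star c)) x
    rw [← innerL_smulR_smulR]
    exact M.hiL_pos _) (mul_star_self_nonneg b)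
  change ‖M.innerL (M.smulR x (b * star b)) x‖ ≤ _ * ‖M.innerL (M.smulR x 1) x‖ at h
  rwa [← innerL_smulR_smulR, M.hR_one, CStarRing.norm_self_mul_star, ← pow_two] at h

theorem norm_le_of_mul_self_mul_self {D : Type*} [CStarAlgebra D] {d : D} (hd : star d = d)
    {r : ℝ} (hr : 0 ≤ r) (h : ‖d * d * d‖ ≤ r ^ 2 * ‖d‖) : ‖d‖ ≤ r := by
  have h2 : ‖d * d‖ = ‖d‖ * ‖d‖ := by
    simpa only [hd] using CStarRing.norm_star_mul_self (x := d)
  rcases (norm_nonneg d).eq_or_lt with h0 | h0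
  · rwa [← h0]
  have h4 : ‖d * d * d * d‖ = ‖d‖ ^ 4 := by
    have : d * d * d * d = star (d * d) * (d * d) := by simp [hd, mul_assoc]
    rw [this, CStarRing.norm_star_mul_self, h2]; ring
  have h5 : ‖d‖ ^ 4 ≤ r ^ 2 * ‖d‖ * ‖d‖ := by
    rw [← h4]
    exact (norm_mul_le _ _).trans (by gcongr)
  have h6 : ‖d‖ ^ 2 ≤ r ^ 2 := by
    have : ‖d‖ ^ 2 * ‖d‖ ^ 2 ≤ r ^ 2 * ‖d‖ ^ 2 := by nlinarith
    exact le_of_mul_le_mul_right this (by positivity)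
  exact (pow_le_pow_iff_left₀ h0.le hr two_ne_zero).1 h6

theorem norm_innerL_self (x : M.carrier) : ‖M.innerL x x‖ = ‖M.innerR x x‖ := by
  apply le_antisymm
  · refine norm_le_of_mul_self_mul_self (M.hiL_star x x).symm (norm_nonneg _) ?_
    convert M.norm_innerL_smulR_le x (M.innerR x x) using 2
    rw [← M.h_imp, M.hiL_smul, innerL_smul_right, ← M.hiL_star, mul_assoc]
  · refine norm_le_of_mul_self_mul_self (M.hiR_star x x).symm (norm_nonneg _) ?_
    convert M.norm_innerR_smulL_le (M.innerL x x) x using 2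
    rw [M.h_imp, M.hiR_smul, innerR_smul_left, ← M.hiR_star]

theorem norm_smulL_le (a : A) (x : M.carrier) : ‖M.smulL a x‖ ≤ ‖a‖ * ‖x‖ := by
  rw [← pow_le_pow_iff_left₀ (norm_nonneg _) (by positivity) two_ne_zero, mul_pow, M.h_norm,
    M.h_norm]
  exact M.norm_innerR_smulL_le a x

/-- The conjugate bimodule. -/
def symm : ImprimitivityBimodule B A where
  carrier := M.carrier
  smulL b x := M.smulR x (star b)
  smulR x a := M.smulL (star a) x
  innerL := M.innerR
  innerR := M.innerL
  hL_one x := by rw [star_one, M.hR_one]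
  hL_mul b b' x := by rw [star_mul, M.hR_mul]
  hL_add b x y := M.hR_add x y _
  hL_add' b b' x := by rw [star_add, M.hR_add']
  hR_one x := by rw [star_one, M.hL_one]
  hR_mul x a a' := by rw [star_mul, M.hL_mul]
  hR_add x y a := M.hL_add _ x y
  hR_add' x a a' := by rw [star_add, M.hL_add']
  h_compat b x a := (M.h_compat _ _ _).symm
  hiL_add := M.hiR_add_left
  hiL_smul b x y := by rw [innerR_smul_left, star_star]
  hiL_star := M.hiR_star
  hiL_pos := M.hiR_pos
  hiL_def := M.hiR_def
  hiR_add := M.hiL_add_right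
  hiR_smul x y a := by rw [innerL_smul_right, star_star]
  hiR_star := M.hiL_star
  hiR_pos := M.hiL_pos
  hiR_def := M.hiL_def
  h_fullL := M.h_fullR
  h_fullR := M.h_fullL
  h_norm x := by rw [M.h_norm, norm_innerL_self]
  h_imp x y z := by rw [← M.hiR_star, ← M.hiL_star, M.h_imp]

/-- A full left Hilbert module over a unital algebra has a finite normalized tight frame. -/
theorem exists_frameL : ∃ (n : ℕ) (x : Fin n → M.carrier), ∑ i, M.innerL (x i) (x i) = 1 := by
  obtain ⟨n, x, y, hxy⟩ := M.exists_sum_innerL_eq_one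
  let z : Fin (n + n) → M.carrier := Fin.append x y
  have hle : (1 : A) ≤ ∑ i, M.innerL (z i) (z i) := by
    have h2 : (1 : A) + 1 ≤ ∑ i, M.innerL (z i) (z i) := by
      have hyx : ∑ i, M.innerL (y i) (x i) = 1 := by
        simp only [M.hiL_star (x _) (y _)]
        rw [← star_sum, hxy, star_one]
      simp only [z, Fin.sum_univ_add, Fin.append_left, Fin.append_right]
      calc (1 : A) + 1 = ∑ i, M.innerL (x i) (y i) + ∑ i, M.innerL (y i) (x i) := by rw [hxy, hyx]
        _ = ∑ i, (M.innerL (x i) (y i) + M.innerL (y i) (x i)) := Finset.sum_add_distrib.symm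
        _ ≤ ∑ i, (M.innerL (x i) (x i) + M.innerL (y i) (y i)) := Finset.sum_le_sum fun i _ => by
          have := M.hiL_pos (x i - y i)
          rw [innerL_sub_left, innerL_sub_right, innerL_sub_right] at this
          rw [← sub_nonneg]
          convert this using 1
          abel
        _ = _ := Finset.sum_add_distrib
    exact (le_add_of_nonneg_left zero_le_one).trans h2
  have hpos : IsStrictlyPositive (∑ i, M.innerL (z i) (z i)) :=
    (CStarAlgebra.isUnit_of_le 1 hle).isStrictlyPositive (zero_le_one.trans hle)
  obtain ⟨b, ⟨u, rfl⟩, hb⟩ := CStarAlgebra.isStrictlyPositive_iff_eq_star_mul_self.1 hpos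
  refine ⟨n + n, fun i => M.smulL (star (↑u⁻¹ : A)) (z i), ?_⟩
  simp only [M.hiL_smul, innerL_smul_right, star_star]
  rw [← Finset.mul_sum, ← Finset.sum_mul, hb, mul_assoc, Units.mul_inv, mul_one, ← star_mul,
    Units.mul_inv, star_one]

theorem exists_frameR : ∃ (n : ℕ) (x : Fin n → M.carrier), ∑ i, M.innerR (x i) (x i) = 1 :=
  M.symm.exists_frameL

/-- The number of elements of a chosen left frame. -/
noncomputable def cardL : ℕ := M.exists_frameL.choose

/-- A chosen left frame. -/
noncomputable def frameL : Fin M.cardL → M.carrier := M.exists_frameL.choose_spec.choose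

theorem sum_frameL : ∑ i, M.innerL (M.frameL i) (M.frameL i) = 1 :=
  M.exists_frameL.choose_spec.choose_spec

/-- The number of elements of a chosen right frame. -/
noncomputable def cardR : ℕ := M.exists_frameR.choose

/-- A chosen right frame. -/
noncomputable def frameR : Fin M.cardR → M.carrier := M.exists_frameR.choose_spec.choose

theorem sum_frameR : ∑ i, M.innerR (M.frameR i) (M.frameR i) = 1 :=
  M.exists_frameR.choose_spec.choose_spec

theorem sum_smulR_frameL (y : M.carrier) :
    ∑ i, M.smulR (M.frameL i) (M.innerR (M.frameL i) y) = y := by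
  simp only [← M.h_imp]
  rw [← sum_smulL, sum_frameL, M.hL_one]

theorem sum_smulL_frameR (y : M.carrier) :
    ∑ i, M.smulL (M.innerL y (M.frameR i)) (M.frameR i) = y := by
  simp only [M.h_imp]
  rw [← smulR_sum, sum_frameR, M.hR_one]

end Basic

/-- A unital C*-algebra as a bimodule over itself. -/
noncomputable def refl (A : Type u) [CStarAlgebra A] [PartialOrder A] [StarOrderedRing A] :
    ImprimitivityBimodule A A where
  carrier := A
  smulL a x := a * x
  smulR x a := x * a
  innerL x y := x * star y
  innerR x y := star x * y
  hL_one := one_mul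
  hL_mul := mul_assoc
  hL_add := mul_add
  hL_add' := add_mul
  hR_one := mul_one
  hR_mul x a b := (mul_assoc x a b).symm
  hR_add := add_mul
  hR_add' := mul_add
  h_compat := mul_assoc
  hiL_add x y z := add_mul x y _
  hiL_smul a x y := mul_assoc a x _
  hiL_star x y := by simp
  hiL_pos := mul_star_self_nonneg
  hiL_def x := CStarRing.mul_star_self_eq_zero_iff x |>.1
  hiR_add x y z := mul_add _ y z
  hiR_smul x y b := (mul_assoc _ y b).symm
  hiR_star x y := by simp
  hiR_pos := star_mul_self_nonneg
  hiR_def x := CStarRing.star_mul_self_eq_zero_iff x |>.1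
  h_fullL := Set.eq_univ_of_forall fun a =>
    subset_closure (Submodule.subset_span ⟨(a, 1), by simp⟩)
  h_fullR := Set.eq_univ_of_forall fun a =>
    subset_closure (Submodule.subset_span ⟨(1, a), by simp⟩)
  h_norm x := by rw [CStarRing.norm_star_mul_self, pow_two]
  h_imp x y z := mul_assoc x _ z

section InnerNorm

variable {C : Type*} [CStarAlgebra C] [PartialOrder C] [StarOrderedRing C]

open ComplexConjugate in
/-- The norm `‖x‖ = ‖⟪x, x⟫‖ ^ (1 / 2)` of a right pre-Hilbert module with definite inner
product. -/
@[reducible]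
noncomputable def innerNormedAddCommGroup {E : Type*} [AddCommGroup E] (act : E → C → E)
    (ip : E → E → C) (act_one : ∀ x, act x 1 = x)
    (act_mul : ∀ x c d, act x (c * d) = act (act x c) d)
    (act_add : ∀ x y c, act (x + y) c = act x c + act y c)
    (act_add' : ∀ x c d, act x (c + d) = act x c + act x d)
    (ip_add : ∀ x y z, ip x (y + z) = ip x y + ip x z)
    (ip_act : ∀ x y c, ip x (act y c) = ip x y * c)
    (ip_star : ∀ x y, ip y x = star (ip x y))
    (ip_pos : ∀ x, 0 ≤ ip x x) (ip_def : ∀ x, ip x x = 0 → x = 0) :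
    NormedAddCommGroup E :=
  letI : SMul C E := ⟨fun c x => act x (star c)⟩
  letI : Module ℂ E :=
    { smul := fun z x => act x (algebraMap ℂ C (conj z))
      one_smul := fun x => by
        change act x (algebraMap ℂ C (conj 1)) = x
        rw [map_one, map_one, act_one]
      mul_smul := fun z w x => by
        change act x (algebraMap ℂ C (conj (z * w))) =
          act (act x (algebraMap ℂ C (conj w))) (algebraMap ℂ C (conj z))
        rw [← act_mul, ← map_mul, ← map_mul, mul_comm]
      smul_zero := fun z => by
        have := act_add 0 0 (algebraMap ℂ C (conj z))
        rw [add_zero] at this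
        exact left_eq_add.1 this
      smul_add := fun z x y => act_add x y _
      add_smul := fun z w x => by
        change act x (algebraMap ℂ C (conj (z + w))) = _
        rw [map_add, map_add, act_add']
        rfl
      zero_smul := fun x => by
        change act x (algebraMap ℂ C (conj 0)) = 0
        have := act_add' x 0 0
        rw [add_zero] at this
        rw [map_zero, map_zero]
        exact left_eq_add.1 this }
  letI : Norm E := ⟨fun x => √‖ip x x‖⟩
  have ip_add_left : ∀ x y z, ip (x + y) z = ip x z + ip y z := fun x y z => by
    rw [ip_star, ip_add, star_add, ← ip_star, ← ip_star]
  letI : CStarModule C E :=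
    { inner := fun x y => ip y x
      inner_add_right := fun {x y z} => ip_add_left y z x
      inner_self_nonneg := fun {x} => ip_pos x
      inner_self := fun {x} => ⟨ip_def x, by
        rintro rfl
        have := ip_add 0 0 0
        rw [add_zero] at this
        exact left_eq_add.1 this⟩
      inner_op_smul_right := fun {a x y} => by
        change ip (act y (star a)) x = a * ip y x
        rw [ip_star, ip_act, star_mul, star_star, ← ip_star]
      inner_smul_right_complex := fun {z x y} => by
        change ip (act y (algebraMap ℂ C (conj z))) x = z • ip y x
        rw [ip_star, ip_act, star_mul, ← ip_star, ← algebraMap_star_comm, Algebra.smul_def]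
        simp
      star_inner := fun x y => (ip_star y x).symm
      norm_eq_sqrt_norm_inner_self := fun x => rfl }
  CStarModule.normedAddCommGroup C

end InnerNorm

section Comp

variable {A B C : Type u} [CStarAlgebra A] [PartialOrder A] [StarOrderedRing A]
  [CStarAlgebra B] [PartialOrder B] [StarOrderedRing B]
  [CStarAlgebra C] [PartialOrder C] [StarOrderedRing C]
  (M : ImprimitivityBimodule A B) (N : ImprimitivityBimodule B C)

/-- The interior tensor product `M ⊗_B N` of bimodules over unital algebras, realized as the space
of conjugate `B`-module maps from `M` to `N`; the elementary tensor `m ⊗ n` is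
`y ↦ ⟨y, m⟩_B · n`. -/
def Tensor : AddSubgroup (M.carrier →+ N.carrier) where
  carrier := {T | ∀ x b, T (M.smulR x b) = N.smulL (star b) (T x)}
  zero_mem' x b := (N.smulL_zero _).symm
  add_mem' {T S} hT hS x b := by
    change T _ + S _ = N.smulL _ (T x + S x)
    rw [hT, hS, N.hL_add]
  neg_mem' {T} hT x b := by
    change -T _ = N.smulL _ (-T x)
    rw [hT]
    exact (map_neg (N.actL (star b)) (T x)).symm

namespace Tensor

variable {M N}

theorem ext {T S : Tensor M N} (h : ∀ y, T.1 y = S.1 y) : T = S :=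
  Subtype.ext (AddMonoidHom.ext h)

theorem map_smulR (T : Tensor M N) (x : M.carrier) (b : B) :
    T.1 (M.smulR x b) = N.smulL (star b) (T.1 x) := T.2 x b

/-- A map out of the conjugate of `M` is determined by its values on a frame. -/
theorem apply_eq (T : Tensor M N) (y : M.carrier) :
    T.1 y = ∑ i, N.smulL (M.innerR y (M.frameL i)) (T.1 (M.frameL i)) := by
  conv_lhs => rw [← M.sum_smulR_frameL y, map_sum]
  refine Finset.sum_congr rfl fun i _ => ?_
  rw [map_smulR, ← M.hiR_star]

/-- The left action on the tensor product. -/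
def smulL (a : A) (T : Tensor M N) : Tensor M N :=
  ⟨T.1.comp (M.actL (star a)), fun x b => by
    change T.1 (M.smulL (star a) (M.smulR x b)) = N.smulL (star b) (T.1 (M.smulL (star a) x))
    rw [← M.h_compat, T.2]⟩

/-- The right action on the tensor product. -/
def smulR (T : Tensor M N) (c : C) : Tensor M N :=
  ⟨(N.actR.flip c).comp T.1, fun x b => by
    change N.smulR (T.1 (M.smulR x b)) c = N.smulL (star b) (N.smulR (T.1 x) c)
    rw [T.2, N.h_compat]⟩

/-- The elementary tensor `m ⊗ n`. -/
def tmul (m : M.carrier) (n : N.carrier) : Tensor M N :=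
  ⟨(N.actL.flip n).comp (M.ipR.flip m), fun x b => by
    change N.smulL (M.innerR (M.smulR x b) m) n = N.smulL (star b) (N.smulL (M.innerR x m) n)
    rw [innerR_smul_left, N.hL_mul]⟩

theorem smulL_apply (a : A) (T : Tensor M N) (y : M.carrier) :
    (smulL a T).1 y = T.1 (M.smulL (star a) y) := rfl

theorem smulR_apply (T : Tensor M N) (c : C) (y : M.carrier) :
    (smulR T c).1 y = N.smulR (T.1 y) c := rfl

theorem tmul_apply (m : M.carrier) (n : N.carrier) (y : M.carrier) :
    (tmul m n).1 y = N.smulL (M.innerR y m) n := rfl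

theorem add_apply (T S : Tensor M N) (y : M.carrier) : (T + S).1 y = T.1 y + S.1 y := rfl

theorem sub_apply (T S : Tensor M N) (y : M.carrier) : (T - S).1 y = T.1 y - S.1 y := rfl

/-- The adjoint `N → M`, which sends `w` to `m · ⟨n, w⟩` when `T = m ⊗ n`. -/
noncomputable def adj (T : Tensor M N) (w : N.carrier) : M.carrier :=
  ∑ i, M.smulR (M.frameL i) (N.innerL (T.1 (M.frameL i)) w)

theorem innerR_adj (T : Tensor M N) (y : M.carrier) (w : N.carrier) :
    M.innerR y (adj T w) = N.innerL (T.1 y) w := by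
  rw [apply_eq, innerL_sum_left, adj, innerR_sum_right]
  simp only [M.hiR_smul, N.hiL_smul]

theorem adj_add (T S : Tensor M N) (w : N.carrier) : adj (T + S) w = adj T w + adj S w :=
  M.eq_of_innerR fun z => by
    rw [M.hiR_add, innerR_adj, innerR_adj, innerR_adj, add_apply, N.hiL_add]

theorem adj_smulL (a : A) (T : Tensor M N) (w : N.carrier) :
    adj (smulL a T) w = M.smulL a (adj T w) :=
  M.eq_of_innerR fun z => by
    rw [← star_star a, ← innerR_smulL_left, star_star, innerR_adj, innerR_adj, smulL_apply]

theorem adj_tmul (m : M.carrier) (n w : N.carrier) :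
    adj (tmul m n) w = M.smulR m (N.innerL n w) :=
  M.eq_of_innerR fun z => by
    rw [innerR_adj, tmul_apply, N.hiL_smul, M.hiR_smul]

/-- The left inner product, `⟨m ⊗ n, m' ⊗ n'⟩ = ⟨m · ⟨n, n'⟩, m'⟩`. -/
noncomputable def innerL (T S : Tensor M N) : A :=
  ∑ k, M.innerL (adj T (N.frameR k)) (adj S (N.frameR k))

/-- The right inner product, `⟨m ⊗ n, m' ⊗ n'⟩ = ⟨n, ⟨m, m'⟩ · n'⟩`. -/
noncomputable def innerR (T S : Tensor M N) : C :=
  ∑ i, N.innerR (T.1 (M.frameL i)) (S.1 (M.frameL i))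

theorem sum_innerL_mul_innerL (n n' : N.carrier) :
    ∑ k, N.innerL n (N.frameR k) * N.innerL (N.frameR k) n' = N.innerL n n' := by
  simp only [← N.hiL_smul]
  rw [← innerL_sum_left, sum_smulL_frameR]

theorem sum_innerR_mul_innerR (m m' : M.carrier) :
    ∑ i, M.innerR m (M.frameL i) * M.innerR (M.frameL i) m' = M.innerR m m' := by
  simp only [← M.hiR_smul]
  rw [← innerR_sum_right, sum_smulR_frameL]

theorem innerL_tmul (m m' : M.carrier) (n n' : N.carrier) :
    innerL (tmul m n) (tmul m' n') = M.innerL (M.smulR m (N.innerL n n')) m' := by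
  simp only [innerL, adj_tmul]
  rw [← sum_innerL_mul_innerL n n', smulR_sum, innerL_sum_left]
  refine Finset.sum_congr rfl fun k _ => ?_
  rw [M.hR_mul, innerL_smulR_left _ _ _ (N.innerL _ n'), ← N.hiL_star]

theorem innerR_tmul (m m' : M.carrier) (n n' : N.carrier) :
    innerR (tmul m n) (tmul m' n') = N.innerR n (N.smulL (M.innerR m m') n') := by
  simp only [innerR, tmul_apply]
  rw [← sum_innerR_mul_innerR m m', sum_smulL, innerR_sum_right]
  refine Finset.sum_congr rfl fun k _ => ?_
  rw [N.hL_mul, innerR_smulL_left, ← M.hiR_star]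

theorem innerL_add (T S U : Tensor M N) : innerL (T + S) U = innerL T U + innerL S U := by
  simp only [innerL, adj_add, M.hiL_add, Finset.sum_add_distrib]

theorem innerL_smulL (a : A) (T S : Tensor M N) : innerL (smulL a T) S = a * innerL T S := by
  simp only [innerL, adj_smulL, M.hiL_smul, Finset.mul_sum]

theorem innerL_star (T S : Tensor M N) : innerL S T = star (innerL T S) := by
  simp only [innerL, star_sum, ← M.hiL_star]

theorem innerL_self_nonneg (T : Tensor M N) : 0 ≤ innerL T T :=
  Finset.sum_nonneg fun _ _ => M.hiL_pos _

theorem eq_zero_of_innerL_self (T : Tensor M N) (h : innerL T T = 0) : T = 0 := by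
  have h0 := (Finset.sum_eq_zero_iff_of_nonneg fun _ _ => M.hiL_pos _).1 h
  refine ext fun y => ?_
  rw [← N.sum_smulL_frameR (T.1 y)]
  refine Finset.sum_eq_zero fun k hk => ?_
  rw [← innerR_adj, M.hiL_def _ (h0 k hk), innerR_zero_right]
  exact DFunLike.congr_fun (map_zero N.actL) _

theorem innerR_add (T S U : Tensor M N) : innerR T (S + U) = innerR T S + innerR T U := by
  simp only [innerR, add_apply, N.hiR_add, Finset.sum_add_distrib]

theorem innerR_smulR (T S : Tensor M N) (c : C) : innerR T (smulR S c) = innerR T S * c := by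
  simp only [innerR, smulR_apply, N.hiR_smul, Finset.sum_mul]

theorem innerR_star (T S : Tensor M N) : innerR S T = star (innerR T S) := by
  simp only [innerR, star_sum, ← N.hiR_star]

theorem innerR_self_nonneg (T : Tensor M N) : 0 ≤ innerR T T :=
  Finset.sum_nonneg fun _ _ => N.hiR_pos _

theorem eq_zero_of_innerR_self (T : Tensor M N) (h : innerR T T = 0) : T = 0 := by
  have h0 := (Finset.sum_eq_zero_iff_of_nonneg fun _ _ => N.hiR_pos _).1 h
  refine ext fun y => ?_
  rw [apply_eq]
  refine Finset.sum_eq_zero fun i hi => ?_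
  rw [N.hiR_def _ (h0 i hi), smulL_zero]

theorem smulL_innerL (T S U : Tensor M N) : smulL (innerL T S) U = smulR T (innerR S U) := by
  refine ext fun y => ?_
  have hl : (smulL (innerL T S) U).1 y =
      ∑ k, N.smulL (N.innerL (T.1 y) (N.frameR k)) (U.1 (adj S (N.frameR k))) := by
    rw [smulL_apply, ← innerL_star, innerL, sum_smulL, map_sum]
    refine Finset.sum_congr rfl fun k _ => ?_
    rw [M.h_imp, map_smulR, ← M.hiR_star, innerR_adj]
  rw [hl, smulR_apply, innerR, smulR_sum]
  simp only [adj, map_sum, map_smulR, smulL_sum, ← N.hL_mul, ← N.hiL_star, ← N.h_imp]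
  rw [Finset.sum_comm]
  refine Finset.sum_congr rfl fun i _ => ?_
  rw [← sum_smulL, sum_innerL_mul_innerL]

theorem sum_innerL_tmul : ∑ i, ∑ j, innerL (tmul (M.frameL i) (N.frameL j))
    (tmul (M.frameL i) (N.frameL j)) = 1 := by
  rw [← M.sum_frameL]
  refine Finset.sum_congr rfl fun i _ => ?_
  simp only [innerL_tmul]
  rw [← innerL_sum_left, ← smulR_sum, N.sum_frameL, M.hR_one]

theorem sum_innerR_tmul : ∑ k, ∑ l, innerR (tmul (M.frameR l) (N.frameR k))
    (tmul (M.frameR l) (N.frameR k)) = 1 := by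
  rw [← N.sum_frameR]
  refine Finset.sum_congr rfl fun i _ => ?_
  simp only [innerR_tmul]
  rw [← innerR_sum_right, ← sum_smulL, M.sum_frameR, N.hL_one]

theorem smulR_one (T : Tensor M N) : smulR T 1 = T := ext fun _ => N.hR_one _

theorem smulR_mul (T : Tensor M N) (c d : C) : smulR T (c * d) = smulR (smulR T c) d :=
  ext fun _ => N.hR_mul _ _ _

theorem add_smulR (T S : Tensor M N) (c : C) : smulR (T + S) c = smulR T c + smulR S c :=
  ext fun _ => N.hR_add _ _ _

theorem smulR_add (T : Tensor M N) (c d : C) : smulR T (c + d) = smulR T c + smulR T d :=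
  ext fun _ => N.hR_add' _ _ _

noncomputable instance : NormedAddCommGroup (Tensor M N) :=
  innerNormedAddCommGroup smulR innerR smulR_one smulR_mul add_smulR smulR_add innerR_add
    innerR_smulR innerR_star innerR_self_nonneg eq_zero_of_innerR_self

theorem norm_sq (T : Tensor M N) : ‖T‖ ^ 2 = ‖innerR T T‖ := Real.sq_sqrt (norm_nonneg _)

theorem norm_apply_frameL_le (T : Tensor M N) (i : Fin M.cardL) : ‖T.1 (M.frameL i)‖ ≤ ‖T‖ := by
  rw [← pow_le_pow_iff_left₀ (norm_nonneg _) (norm_nonneg _) two_ne_zero, norm_sq, N.h_norm]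
  exact norm_le_norm_of_nonneg_of_le (N.hiR_pos _)
    (Finset.single_le_sum (f := fun i => N.innerR (T.1 (M.frameL i)) (T.1 (M.frameL i)))
      (fun _ _ => N.hiR_pos _) (Finset.mem_univ i))

theorem norm_sq_le (T : Tensor M N) : ‖T‖ ^ 2 ≤ ∑ i, ‖T.1 (M.frameL i)‖ ^ 2 := by
  simp only [norm_sq, N.h_norm]
  exact norm_sum_le _ _

open Filter Topology in
instance : CompleteSpace (Tensor M N) := by
  refine Metric.complete_of_cauchySeq_tendsto fun u hu => ?_
  have hlim : ∀ i, ∃ v, Tendsto (fun n => (u n).1 (M.frameL i)) atTop (𝓝 v) := fun i =>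
    cauchySeq_tendsto_of_complete (UniformContinuous.comp_cauchySeq
      (f := fun T : Tensor M N => T.1 (M.frameL i))
      (LipschitzWith.of_dist_le_mul (K := 1) fun T S => by
        rw [NNReal.coe_one, one_mul, dist_eq_norm, dist_eq_norm, ← sub_apply]
        exact norm_apply_frameL_le _ i).uniformContinuous hu)
  choose v hv using hlim
  have hcont : ∀ b : B, Continuous (N.smulL b) := fun b =>
    (LipschitzWith.of_dist_le_mul (K := ‖b‖₊) fun x y => by
      rw [dist_eq_norm, dist_eq_norm, ← smulL_sub]
      exact N.norm_smulL_le b _).continuous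
  have hy : ∀ y, Tendsto (fun n => (u n).1 y) atTop
      (𝓝 (∑ i, N.smulL (M.innerR y (M.frameL i)) (v i))) := fun y => by
    simp only [fun n => apply_eq (u n) y]
    exact tendsto_finsetSum _ fun i _ => ((hcont _).tendsto _).comp (hv i)
  let T : Tensor M N := ⟨AddMonoidHom.mk' (fun y =>
    ∑ i, N.smulL (M.innerR y (M.frameL i)) (v i)) fun x y => by
      simp only [hiR_add_left, N.hL_add', Finset.sum_add_distrib], fun x b => by
      simp only [AddMonoidHom.mk'_apply, innerR_smul_left, N.hL_mul, smulL_sum]⟩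
  refine ⟨T, ?_⟩
  rw [tendsto_iff_norm_sub_tendsto_zero]
  have hsq : Tendsto (fun n => ‖u n - T‖ ^ 2) atTop (𝓝 0) := by
    refine squeeze_zero (fun n => by positivity) (fun n => norm_sq_le _) ?_
    rw [show (0 : ℝ) = ∑ _i : Fin M.cardL, 0 by simp]
    refine tendsto_finsetSum _ fun i _ => ?_
    have h := (tendsto_iff_norm_sub_tendsto_zero.1 (hy (M.frameL i))).pow 2
    rwa [zero_pow two_ne_zero] at h
  simpa using hsq.sqrt

end Tensor

theorem closure_span_eq_univ {D X ι κ : Type*} [CStarAlgebra D] [Fintype ι] [Fintype κ]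
    (ip : X → X → D) (act : D → X → X) (hact : ∀ d x y, ip (act d x) y = d * ip x y)
    (t : ι → κ → X) (ht : ∑ i, ∑ j, ip (t i j) (t i j) = 1) :
    closure (↑(Submodule.span ℂ (Set.range fun p : X × X => ip p.1 p.2)) : Set D) = Set.univ := by
  refine Set.eq_univ_of_forall fun d => subset_closure ?_
  rw [← mul_one d, ← ht, Finset.mul_sum]
  refine Submodule.sum_mem _ fun i _ => ?_
  rw [Finset.mul_sum]
  refine Submodule.sum_mem _ fun j _ => ?_
  rw [← hact]
  exact Submodule.subset_span ⟨(_, _), rfl⟩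

/-- The interior tensor product of imprimitivity bimodules. -/
noncomputable def comp : ImprimitivityBimodule A C where
  carrier := Tensor M N
  smulL := Tensor.smulL
  smulR := Tensor.smulR
  innerL := Tensor.innerL
  innerR := Tensor.innerR
  hL_one T := Tensor.ext fun y => by rw [Tensor.smulL_apply, star_one, M.hL_one]
  hL_mul a a' T := Tensor.ext fun y => by
    simp only [Tensor.smulL_apply, star_mul, M.hL_mul]
  hL_add a T S := Tensor.ext fun _ => rfl
  hL_add' a a' T := Tensor.ext fun y => by
    simp only [Tensor.add_apply, Tensor.smulL_apply, star_add, M.hL_add', map_add]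
  hR_one := Tensor.smulR_one
  hR_mul := Tensor.smulR_mul
  hR_add := Tensor.add_smulR
  hR_add' := Tensor.smulR_add
  h_compat a T c := Tensor.ext fun _ => rfl
  hiL_add := Tensor.innerL_add
  hiL_smul := Tensor.innerL_smulL
  hiL_star := Tensor.innerL_star
  hiL_pos := Tensor.innerL_self_nonneg
  hiL_def := Tensor.eq_zero_of_innerL_self
  hiR_add := Tensor.innerR_add
  hiR_smul := Tensor.innerR_smulR
  hiR_star := Tensor.innerR_star
  hiR_pos := Tensor.innerR_self_nonneg
  hiR_def := Tensor.eq_zero_of_innerR_self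
  h_fullL := closure_span_eq_univ _ Tensor.smulL Tensor.innerL_smulL _ Tensor.sum_innerL_tmul
  h_fullR := closure_span_eq_univ _ (fun c T => Tensor.smulR T (star c)) (fun c T S => by
    rw [Tensor.innerR_star, Tensor.innerR_smulR, star_mul, star_star, ← Tensor.innerR_star])
    _ Tensor.sum_innerR_tmul
  h_norm := Tensor.norm_sq
  h_imp := Tensor.smulL_innerL

end Comp

end ImprimitivityBimodule

/-- Strong Morita equivalence of unital C*-algebras is reflexive, symmetric and
transitive. -/
theorem stronglyMoritaEquivalent_equivalence :
    (∀ (A : Type u) [CStarAlgebra A] [PartialOrder A] [StarOrderedRing A],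
      StronglyMoritaEquivalent A A) ∧
    (∀ (A B : Type u) [CStarAlgebra A] [PartialOrder A] [StarOrderedRing A]
      [CStarAlgebra B] [PartialOrder B] [StarOrderedRing B],
      StronglyMoritaEquivalent A B → StronglyMoritaEquivalent B A) ∧
    (∀ (A B C : Type u) [CStarAlgebra A] [PartialOrder A] [StarOrderedRing A]
      [CStarAlgebra B] [PartialOrder B] [StarOrderedRing B]
      [CStarAlgebra C] [PartialOrder C] [StarOrderedRing C],
      StronglyMoritaEquivalent A B → StronglyMoritaEquivalent B C →
        StronglyMoritaEquivalent A C) := by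
  refine ⟨fun A _ _ _ => ⟨.refl A⟩, fun A B _ _ _ _ _ _ ⟨M⟩ => ⟨M.symm⟩,
    fun A B C _ _ _ _ _ _ _ _ _ ⟨M⟩ ⟨N⟩ => ⟨M.comp N⟩⟩
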